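/- Let A be an m×n real matrix with m < n, let x ∈ ℝⁿ be supported on N ⊆ {1,…,n} with |N| = s, and put y := Ax. Let T ⊆ {1,…,n} with |T| = k and Δ = T^c ∩ N with |Δ| = u, and let w ∈ [0,1]. Suppose δ ≥ 0 satisfies the (k+u)-restricted isometry inequality for A, θ₁ ≥ 0 satisfies the (k+u, k+u)-restricted orthogonality inequality for A, θ₂ ≥ 0 satisfies the (k+u, 2(k+u))-restricted orthogonality inequality for A, and √((k·w² + u)/(k + u))·θ₁ + δ + θ₂ < 1. Then x is the unique minimizer of the weighted 1-norm ‖z‖₁,w := w·Σ_{i∈T}|zᵢ| + Σ_{i∉T}|zᵢ| subject to Az = y: every z ∈ ℝⁿ with Az = y and z ≠ x satisfies ‖z‖₁,w > ‖x‖₁,w. -/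

import Mathlib

open Classical Finset

/-- The 0-norm: number of nonzero components of a vector. -/
noncomputable def norm0 {n : ℕ} (z : Fin n → ℝ) : ℕ :=
  (Finset.univ.filter fun i => z i ≠ 0).card

/-- The 1-norm of a vector. -/
noncomputable def norm1 {n : ℕ} (z : Fin n → ℝ) : ℝ := ∑ i, |z i|

/-- `δ` satisfies the `k`-restricted isometry inequality for `A`. -/
def RIPineq {m n : ℕ} (A : Matrix (Fin m) (Fin n) ℝ) (k : ℕ) (δ : ℝ) : Prop :=
  ∀ z : Fin n → ℝ, norm0 z ≤ k →
    (1 - δ) * (∑ i, z i ^ 2) ≤ ∑ j, (A.mulVec z j) ^ 2 ∧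
      ∑ j, (A.mulVec z j) ^ 2 ≤ (1 + δ) * (∑ i, z i ^ 2)

/-- `θ` satisfies the `(s,s')`-restricted orthogonality inequality for `A`. -/
def ROineq {m n : ℕ} (A : Matrix (Fin m) (Fin n) ℝ) (s s' : ℕ) (θ : ℝ) : Prop :=
  ∀ u v : Fin n → ℝ, (∀ i, u i = 0 ∨ v i = 0) → norm0 u ≤ s → norm0 v ≤ s' →
    |∑ j, A.mulVec u j * A.mulVec v j| ≤
      θ * Real.sqrt (∑ i, u i ^ 2) * Real.sqrt (∑ i, v i ^ 2)

/-- The restriction of `z` to the index set `S` (zero outside `S`). -/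
noncomputable def restrict {n : ℕ} (z : Fin n → ℝ) (S : Finset (Fin n)) : Fin n → ℝ :=
  fun i => if i ∈ S then z i else 0

lemma exists_top {n : ℕ} (h : Fin n → ℝ) (Q : Finset (Fin n)) (p : ℕ) (hp : p ≤ Q.card) :
    ∃ P, P ⊆ Q ∧ P.card = p ∧ ∀ i ∈ Q \ P, ∀ j ∈ P, |h i| ≤ |h j| := by
  induction p with
  | zero => exact ⟨∅, by simp, by simp, by simp⟩
  | succ p ih =>
    obtain ⟨P, hPQ, hPc, hP⟩ := ih (by omega)
    have hne : (Q \ P).Nonempty := by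
      rw [← Finset.card_pos, Finset.card_sdiff_of_subset hPQ]; omega
    obtain ⟨a, ha, hmax⟩ := Finset.exists_max_image (Q \ P) (fun i => |h i|) hne
    have ha' := Finset.mem_sdiff.1 ha
    refine ⟨insert a P, ?_, ?_, ?_⟩
    · exact Finset.insert_subset ha'.1 hPQ
    · rw [Finset.card_insert_of_notMem ha'.2, hPc]
    · intro i hi j hj
      simp only [Finset.mem_sdiff, Finset.mem_insert, not_or] at hi hj
      have hi' : i ∈ Q \ P := Finset.mem_sdiff.2 ⟨hi.1, hi.2.2⟩
      rcases hj with rfl | hj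
      · exact hmax i hi'
      · exact hP i hi' j hj

lemma small_block {n : ℕ} (h : Fin n → ℝ) (p : ℕ) (hp : 0 < p) (P Q : Finset (Fin n))
    (hPc : P.card = p) (hQc : Q.card ≤ p) (hPQ : ∀ i ∈ Q, ∀ j ∈ P, |h i| ≤ |h j|) :
    Real.sqrt (∑ i ∈ Q, h i ^ 2) ≤ (∑ i ∈ P, |h i|) / Real.sqrt p := by
  have hp' : (0 : ℝ) < p := by exact_mod_cast hp
  set L := ∑ i ∈ P, |h i| with hL
  have hL0 : 0 ≤ L := Finset.sum_nonneg fun i _ => abs_nonneg _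
  have h1 : ∀ i ∈ Q, h i ^ 2 ≤ (L / p) ^ 2 := by
    intro i hi
    have h2 : (P.card : ℝ) * |h i| ≤ L := by
      have := Finset.card_nsmul_le_sum P (fun j => |h j|) (|h i|) (fun j hj => hPQ i hi j hj)
      simpa [nsmul_eq_mul] using this
    rw [hPc] at h2
    rw [← sq_abs (h i)]
    have : |h i| ≤ L / p := by rw [le_div_iff₀ hp']; linarith
    exact pow_le_pow_left₀ (abs_nonneg _) this 2
  have h3 := Finset.sum_le_card_nsmul Q _ _ h1
  rw [nsmul_eq_mul] at h3
  apply Real.sqrt_le_iff.2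
  refine ⟨by positivity, h3.trans ?_⟩
  rw [div_pow, div_pow, Real.sq_sqrt hp'.le]
  have h4 : (Q.card : ℝ) ≤ p := by exact_mod_cast hQc
  calc (Q.card : ℝ) * (L ^ 2 / p ^ 2) ≤ p * (L ^ 2 / p ^ 2) := by gcongr
    _ = L ^ 2 / p := by field_simp

lemma blocks {n : ℕ} (h : Fin n → ℝ) (p : ℕ) (hp : 0 < p) (U : Finset (Fin n))
    (g : Finset (Fin n) → ℝ) (K : ℝ) (hK : 0 ≤ K)
    (hadd : ∀ Q R, Disjoint Q R → g (Q ∪ R) = g Q + g R)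
    (hg : ∀ Q ⊆ U, Q.card ≤ p → |g Q| ≤ K * Real.sqrt (∑ i ∈ Q, h i ^ 2)) :
    ∀ (c : ℕ) (R P : Finset (Fin n)), R.card ≤ c → R ⊆ U → P.card = p →
      (∀ i ∈ R, ∀ j ∈ P, |h i| ≤ |h j|) →
      |g R| ≤ K * ((∑ i ∈ P, |h i| + ∑ i ∈ R, |h i|) / Real.sqrt p) := by
  have hp' : (0 : ℝ) < p := by exact_mod_cast hp
  have hs : 0 < Real.sqrt p := Real.sqrt_pos.2 hp'
  intro c
  induction c with
  | zero =>
    intro R P hRc hRU hPc hPR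
    have h1 := hg R hRU (by omega)
    have h2 := small_block h p hp P R hPc (by omega) hPR
    have h3 : 0 ≤ ∑ i ∈ R, |h i| := Finset.sum_nonneg fun i _ => abs_nonneg _
    refine h1.trans (mul_le_mul_of_nonneg_left (h2.trans ?_) hK)
    gcongr; linarith
  | succ c ih =>
    intro R P hRc hRU hPc hPR
    by_cases hcase : R.card ≤ p
    · have h1 := hg R hRU hcase
      have h2 := small_block h p hp P R hPc hcase hPR
      have h3 : 0 ≤ ∑ i ∈ R, |h i| := Finset.sum_nonneg fun i _ => abs_nonneg _
      refine h1.trans (mul_le_mul_of_nonneg_left (h2.trans ?_) hK)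
      gcongr; linarith
    · obtain ⟨P', hP'R, hP'c, hP'⟩ := exists_top h R p (by omega)
      have h1 := hg P' (hP'R.trans hRU) hP'c.le
      have h2 := small_block h p hp P P' hPc hP'c.le (fun i hi => hPR i (hP'R hi))
      have h3 := ih (R \ P') P' (by rw [Finset.card_sdiff_of_subset hP'R]; omega)
        (Finset.sdiff_subset.trans hRU) hP'c hP'
      have h4 : g R = g P' + g (R \ P') := by
        rw [← hadd _ _ Finset.disjoint_sdiff, Finset.union_sdiff_of_subset hP'R]
      have h5 : ∑ i ∈ P', |h i| + ∑ i ∈ R \ P', |h i| = ∑ i ∈ R, |h i| := by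
        rw [add_comm, Finset.sum_sdiff hP'R]
      rw [h5] at h3
      rw [h4, add_div, mul_add]
      have h6 := mul_le_mul_of_nonneg_left h2 hK
      exact (abs_add_le _ _).trans (by linarith)

lemma sum_restrict_sq {n : ℕ} (h : Fin n → ℝ) (S : Finset (Fin n)) :
    ∑ i, _root_.restrict h S i ^ 2 = ∑ i ∈ S, h i ^ 2 := by
  simp [_root_.restrict, ite_pow, Finset.sum_ite_mem]

lemma norm0_restrict {n : ℕ} (h : Fin n → ℝ) (S : Finset (Fin n)) :
    norm0 (_root_.restrict h S) ≤ S.card := by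
  apply Finset.card_le_card
  intro i hi
  by_contra hc
  simp [_root_.restrict, hc] at hi

lemma restrict_union {n : ℕ} (h : Fin n → ℝ) (S R : Finset (Fin n)) (hd : Disjoint S R) :
    _root_.restrict h (S ∪ R) = _root_.restrict h S + _root_.restrict h R := by
  ext i
  have := fun hi => Finset.disjoint_left.1 hd (show i ∈ _ from hi)
  simp only [_root_.restrict, Pi.add_apply, Finset.mem_union]
  by_cases h1 : i ∈ S <;> by_cases h2 : i ∈ R <;> simp_all

/-- The bilinear form `⟨A h_S, A h_R⟩`. -/
noncomputable def BF {m n : ℕ} (A : Matrix (Fin m) (Fin n) ℝ) (h : Fin n → ℝ)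
    (S R : Finset (Fin n)) : ℝ :=
  ∑ j, A.mulVec (_root_.restrict h S) j * A.mulVec (_root_.restrict h R) j

lemma BF_add {m n : ℕ} (A : Matrix (Fin m) (Fin n) ℝ) (h : Fin n → ℝ)
    (S Q R : Finset (Fin n)) (hd : Disjoint Q R) :
    BF A h S (Q ∪ R) = BF A h S Q + BF A h S R := by
  simp only [BF, restrict_union h Q R hd, Matrix.mulVec_add, Pi.add_apply, mul_add,
    Finset.sum_add_distrib]

lemma BF_univ {m n : ℕ} (A : Matrix (Fin m) (Fin n) ℝ) (h : Fin n → ℝ)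
    (S : Finset (Fin n)) (hA : A.mulVec h = 0) : BF A h S Finset.univ = 0 := by
  have : _root_.restrict h Finset.univ = h := by ext i; simp [_root_.restrict]
  simp [BF, this, hA]

lemma BF_ro {m n : ℕ} (A : Matrix (Fin m) (Fin n) ℝ) (h : Fin n → ℝ) (p q : ℕ) (θ : ℝ)
    (hRO : ROineq A p q θ) (S R : Finset (Fin n)) (hd : Disjoint S R) (hS : S.card ≤ p)
    (hR : R.card ≤ q) :
    |BF A h S R| ≤ θ * Real.sqrt (∑ i ∈ S, h i ^ 2) * Real.sqrt (∑ i ∈ R, h i ^ 2) := by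
  have := hRO (_root_.restrict h S) (_root_.restrict h R) ?_ ((norm0_restrict h S).trans hS)
    ((norm0_restrict h R).trans hR)
  · rwa [sum_restrict_sq, sum_restrict_sq] at this
  · intro i
    have := fun hi => Finset.disjoint_left.1 hd (show i ∈ _ from hi)
    simp only [_root_.restrict]
    by_cases h1 : i ∈ S <;> simp_all

/-- One test of `A h = 0` against the block `S`, with the other large block `S'`. -/
lemma block_test {m n : ℕ} (A : Matrix (Fin m) (Fin n) ℝ) (h : Fin n → ℝ) (p : ℕ)
    (δ θ₂ C : ℝ) (hA : A.mulVec h = 0) (hRIP : RIPineq A p δ)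
    (hRO2 : ROineq A p (2 * p) θ₂) (S S' R : Finset (Fin n))
    (hS : S.card ≤ p) (hS' : S'.card ≤ p) (hd : Disjoint S S') (hdR : Disjoint (S ∪ S') R)
    (hu : (S ∪ S') ∪ R = Finset.univ)
    (hR : |BF A h S R| ≤ Real.sqrt (∑ i ∈ S, h i ^ 2) * C) (hC : 0 ≤ C) (hθ : 0 ≤ θ₂) :
    (1 - δ) * Real.sqrt (∑ i ∈ S, h i ^ 2) ≤ θ₂ * Real.sqrt (∑ i ∈ S', h i ^ 2) + C := by
  have h0 := BF_univ A h S hA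
  rw [← hu, BF_add A h S _ _ hdR, BF_add A h S _ _ hd] at h0
  have h1 := (hRIP (_root_.restrict h S) ((norm0_restrict h S).trans hS)).1
  rw [sum_restrict_sq] at h1
  have h2 : BF A h S S = ∑ j, (A.mulVec (_root_.restrict h S) j) ^ 2 := by
    simp [BF, sq]
  rw [← h2] at h1
  have h3 := BF_ro A h p (2 * p) θ₂ hRO2 S S' hd hS (by omega)
  have ha : 0 ≤ ∑ i ∈ S, h i ^ 2 := Finset.sum_nonneg fun i _ => sq_nonneg _
  have hsq := Real.mul_self_sqrt ha
  set a := Real.sqrt (∑ i ∈ S, h i ^ 2)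
  set b := Real.sqrt (∑ i ∈ S', h i ^ 2)
  have ha0 : 0 ≤ a := Real.sqrt_nonneg _
  have hb0 : 0 ≤ b := Real.sqrt_nonneg _
  rw [← hsq] at h1
  have h4 := abs_le.1 h3
  have h5 := abs_le.1 hR
  rcases ha0.eq_or_lt with h6 | h6
  · rw [← h6]; have := mul_nonneg hθ hb0; linarith
  · refine le_of_mul_le_mul_left ?_ h6
    nlinarith

lemma weighted_cs {n : ℕ} (h : Fin n → ℝ) (T Δ : Finset (Fin n)) (hd : Disjoint T Δ) (w : ℝ) :
    w * ∑ i ∈ T, |h i| + ∑ i ∈ Δ, |h i| ≤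
      Real.sqrt ((T.card : ℝ) * w ^ 2 + Δ.card) * Real.sqrt (∑ i ∈ T ∪ Δ, h i ^ 2) := by
  have key := Real.sum_mul_le_sqrt_mul_sqrt (T ∪ Δ) (fun i => if i ∈ T then w else 1)
    (fun i => |h i|)
  have hΔ : ∀ i ∈ Δ, i ∉ T := fun i hi hT => Finset.disjoint_left.1 hd hT hi
  have e1 : ∑ i ∈ T ∪ Δ, (if i ∈ T then w else 1) * |h i|
      = w * ∑ i ∈ T, |h i| + ∑ i ∈ Δ, |h i| := by
    rw [Finset.sum_union hd, Finset.mul_sum]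
    congr 1
    · exact Finset.sum_congr rfl fun i hi => by simp [hi]
    · exact Finset.sum_congr rfl fun i hi => by simp [hΔ i hi]
  have e2 : ∑ i ∈ T ∪ Δ, (if i ∈ T then w else 1) ^ 2 = (T.card : ℝ) * w ^ 2 + Δ.card := by
    rw [Finset.sum_union hd]
    congr 1
    · rw [Finset.sum_congr rfl (g := fun _ => w ^ 2) (fun i hi => by simp [hi])]
      simp
    · rw [Finset.sum_congr rfl (g := fun _ => (1 : ℝ)) (fun i hi => by simp [hΔ i hi])]
      simp
  rw [e1, e2] at key
  simpa using key

theorem stmt_9 {m n : ℕ} (A : Matrix (Fin m) (Fin n) ℝ) (hmn : m < n)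
    (x : Fin n → ℝ) (N T Δ : Finset (Fin n)) (s k u : ℕ)
    (hsupp : ∀ i, i ∉ N → x i = 0) (hNs : N.card = s)
    (hTk : T.card = k) (hΔdef : Δ = Tᶜ ∩ N) (hΔu : Δ.card = u)
    (w : ℝ) (hw0 : 0 ≤ w) (hw1 : w ≤ 1)
    (y : Fin m → ℝ) (hy : y = A.mulVec x)
    (δ θ₁ θ₂ : ℝ) (hδ0 : 0 ≤ δ) (hθ₁0 : 0 ≤ θ₁) (hθ₂0 : 0 ≤ θ₂)
    (hRIP : RIPineq A (k + u) δ)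
    (hRO1 : ROineq A (k + u) (k + u) θ₁)
    (hRO2 : ROineq A (k + u) (2 * (k + u)) θ₂)
    (hcond : Real.sqrt (((k : ℝ) * w ^ 2 + u) / ((k : ℝ) + u)) * θ₁ + δ + θ₂ < 1) :
    ∀ z : Fin n → ℝ, A.mulVec z = y → z ≠ x →
      w * (∑ i ∈ T, |x i|) + (∑ i ∈ Tᶜ, |x i|) <
        w * (∑ i ∈ T, |z i|) + (∑ i ∈ Tᶜ, |z i|) := by
  intro z hz hzx
  by_contra hcon
  push Not at hcon
  set h : Fin n → ℝ := z - x with hh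
  have hA : A.mulVec h = 0 := by rw [hh, Matrix.mulVec_sub, hz, hy, sub_self]
  have hd : Disjoint T Δ := by
    rw [hΔdef]; exact disjoint_compl_right.mono_right Finset.inter_subset_left
  set T0 := T ∪ Δ with hT0
  have hT0c : T0.card = k + u := by rw [hT0, Finset.card_union_of_disjoint hd, hTk, hΔu]
  have hx0 : ∀ i ∈ T0ᶜ, x i = 0 := by
    intro i hi
    apply hsupp
    intro hN
    by_cases hiT : i ∈ T <;> simp_all
  -- cone condition
  have hsplit : ∀ f : Fin n → ℝ, ∑ i ∈ Tᶜ, |f i| = ∑ i ∈ Δ, |f i| + ∑ i ∈ T0ᶜ, |f i| := by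
    intro f
    have e : Tᶜ = Δ ∪ T0ᶜ := by
      ext i
      have := fun hi => Finset.disjoint_left.1 hd (show i ∈ _ from hi)
      simp only [hT0, Finset.mem_union, Finset.mem_compl]
      tauto
    rw [e, Finset.sum_union]
    exact disjoint_compl_right.mono_left Finset.subset_union_right
  have htri : ∀ S : Finset (Fin n), ∑ i ∈ S, |x i| ≤ ∑ i ∈ S, |z i| + ∑ i ∈ S, |h i| := by
    intro S
    rw [← Finset.sum_add_distrib]
    refine Finset.sum_le_sum fun i _ => ?_
    have : x i = z i - h i := by simp [hh]
    rw [this]; exact abs_sub _ _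
  have hoff : ∑ i ∈ T0ᶜ, |h i| = ∑ i ∈ T0ᶜ, |z i| :=
    Finset.sum_congr rfl fun i hi => by simp [hh, hx0 i hi]
  have hoffx : ∑ i ∈ T0ᶜ, |x i| = 0 :=
    Finset.sum_eq_zero fun i hi => by simp [hx0 i hi]
  rw [hsplit, hsplit, hoffx, ← hoff] at hcon
  have hcone : ∑ i ∈ T0ᶜ, |h i| ≤ w * ∑ i ∈ T, |h i| + ∑ i ∈ Δ, |h i| := by
    have h1 := mul_le_mul_of_nonneg_left (htri T) hw0
    have h2 := htri Δ
    linarith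
  have hcs := hcone.trans (weighted_cs h T Δ hd w)
  rw [hTk, hΔu] at hcs
  -- if `h` vanishes on `T0`, it vanishes
  have hapos : 0 < Real.sqrt (∑ i ∈ T0, h i ^ 2) := by
    rcases (Real.sqrt_nonneg (∑ i ∈ T0, h i ^ 2)).eq_or_lt with h0 | h0
    · exfalso
      apply hzx
      have h1 : ∑ i ∈ T0, h i ^ 2 = 0 :=
        (Real.sqrt_eq_zero (Finset.sum_nonneg fun i _ => sq_nonneg _)).1 h0.symm
      rw [← h0, mul_zero] at hcs
      have h2 : ∑ i ∈ T0ᶜ, |h i| = 0 :=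
        le_antisymm hcs (Finset.sum_nonneg fun i _ => abs_nonneg _)
      rw [Finset.sum_eq_zero_iff_of_nonneg (fun i _ => sq_nonneg _)] at h1
      rw [Finset.sum_eq_zero_iff_of_nonneg (fun i _ => abs_nonneg _)] at h2
      have h3 : h = 0 := by
        ext i
        by_cases hi : i ∈ T0
        · simpa using h1 i hi
        · simpa using h2 i (Finset.mem_compl.2 hi)
      exact sub_eq_zero.1 h3
    · exact h0
  have hp : 0 < k + u := by
    rw [← hT0c, Finset.card_pos]
    by_contra hne
    rw [Finset.not_nonempty_iff_eq_empty] at hne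
    rw [hne] at hapos
    simp at hapos
  set p := k + u with hpdef
  have hp' : (0 : ℝ) < p := by exact_mod_cast hp
  set a := Real.sqrt (∑ i ∈ T0, h i ^ 2) with ha
  set c := Real.sqrt (((k : ℝ) * w ^ 2 + u) / ((k : ℝ) + u)) with hc
  have hcc : c = Real.sqrt ((k : ℝ) * w ^ 2 + u) / Real.sqrt p := by
    rw [hc, Real.sqrt_div (by positivity), hpdef]; push_cast; rfl
  have hc0 : 0 ≤ c := Real.sqrt_nonneg _
  have hcs' : (∑ i ∈ T0ᶜ, |h i|) / Real.sqrt p ≤ c * a := by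
    rw [hcc, div_mul_eq_mul_div]; gcongr
  -- choose the second block
  obtain ⟨T1, hT1s, hT1c, hrest⟩ : ∃ T1 ⊆ T0ᶜ, T1.card ≤ p ∧
      ∀ S : Finset (Fin n), S.card ≤ p → Disjoint S (T0ᶜ \ T1) →
        |BF A h S (T0ᶜ \ T1)| ≤ Real.sqrt (∑ i ∈ S, h i ^ 2) * (θ₁ * (c * a)) := by
    by_cases hcase : (T0ᶜ).card ≤ p
    · refine ⟨T0ᶜ, subset_rfl, hcase, fun S _ _ => ?_⟩
      have : BF A h S (T0ᶜ \ T0ᶜ) = 0 := by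
        have : _root_.restrict h ∅ = 0 := by ext i; simp [_root_.restrict]
        simp [BF, this]
      rw [this, abs_zero]
      have := Real.sqrt_nonneg (∑ i ∈ S, h i ^ 2)
      positivity
    · obtain ⟨P, hPs, hPc, hP⟩ := exists_top h T0ᶜ p (by omega)
      refine ⟨P, hPs, hPc.le, fun S hS hSd => ?_⟩
      have hb := blocks h p hp (T0ᶜ \ P) (BF A h S) (θ₁ * Real.sqrt (∑ i ∈ S, h i ^ 2))
        (by positivity) (fun Q R hQR => BF_add A h S Q R hQR)
        (fun Q hQ hQc => BF_ro A h p p θ₁ hRO1 S Q (hSd.mono_right hQ) hS hQc)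
        _ (T0ᶜ \ P) P le_rfl subset_rfl hPc hP
      rw [add_comm (∑ i ∈ P, |h i|), Finset.sum_sdiff hPs] at hb
      have hS0 : 0 ≤ θ₁ * Real.sqrt (∑ i ∈ S, h i ^ 2) := by positivity
      have := mul_le_mul_of_nonneg_left hcs' hS0
      linarith
  set R := T0ᶜ \ T1 with hR
  have hd01 : Disjoint T0 T1 := disjoint_compl_right.mono_right hT1s
  have hd0R : Disjoint T0 R := disjoint_compl_right.mono_right Finset.sdiff_subset
  have hd1R : Disjoint T1 R := Finset.disjoint_sdiff
  have hun : (T0 ∪ T1) ∪ R = Finset.univ := by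
    rw [Finset.union_assoc, hR, Finset.union_sdiff_of_subset hT1s, Finset.union_compl]
  have hC : 0 ≤ θ₁ * (c * a) := by positivity
  have t0 := block_test A h p δ θ₂ (θ₁ * (c * a)) hA hRIP hRO2 T0 T1 R hT0c.le hT1c hd01
    (Finset.disjoint_union_left.2 ⟨hd0R, hd1R⟩) hun (hrest T0 hT0c.le hd0R) hC hθ₂0
  have t1 := block_test A h p δ θ₂ (θ₁ * (c * a)) hA hRIP hRO2 T1 T0 R hT1c hT0c.le hd01.symm
    (Finset.disjoint_union_left.2 ⟨hd1R, hd0R⟩) (by rw [Finset.union_comm T1]; exact hun)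
    (hrest T1 hT1c hd1R) hC hθ₂0
  rw [← ha] at t0 t1
  set b := Real.sqrt (∑ i ∈ T1, h i ^ 2)
  have hb0 : 0 ≤ b := Real.sqrt_nonneg _
  have hcθ : 0 ≤ c * θ₁ := by positivity
  rcases le_total b a with hba | hab
  · have h1 := mul_le_mul_of_nonneg_left hba hθ₂0
    have h2 := mul_lt_mul_of_pos_right hcond hapos
    linarith
  · have h1 := mul_le_mul_of_nonneg_left hab hθ₂0
    have h2 := mul_lt_mul_of_pos_right hcond (hapos.trans_le hab)
    have h3 := mul_le_mul_of_nonneg_left hab hcθ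
    linarith
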